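/- Suppose in addition that 𝒜₁ and 𝒜₂ are involutive. Then for every A ∈ 𝒜 = Ã₁ ∩ Ã₂, the adjoint tensor A* belongs to 𝒜 and ‖A*‖_𝒜 = ‖A‖_𝒜. -/

import Mathlib

open scoped ComplexConjugate

noncomputable section

namespace PaperTensor

variable {I I₁ I₂ : Type*}

/-- The space `ℓ²(I)`. -/
abbrev L2 (I : Type*) := lp (fun _ : I => ℂ) 2

/-- The continuous linear map `T` represents the matrix `M` as an operator on `ℓ²(I)`,
i.e. `(T c) k = Σ_l M k l * c l` for every `c ∈ ℓ²(I)`. -/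
def Represents (M : I → I → ℂ) (T : L2 I →L[ℂ] L2 I) : Prop :=
  ∀ c : L2 I, ∀ k : I, HasSum (fun l : I => M k l * (c : ∀ _ : I, ℂ) l) ((T c : ∀ _ : I, ℂ) k)

/-- `M` defines a bounded operator on `ℓ²(I)`. -/
def Bounded2 (M : I → I → ℂ) : Prop := ∃ T : L2 I →L[ℂ] L2 I, Represents M T

/-- The operator norm `‖M‖_{B(ℓ²(I))}` of the matrix `M` (junk value `0` if `M` is unbounded). -/
noncomputable def opNorm2 (M : I → I → ℂ) : ℝ :=
  letI : Decidable (Bounded2 M) := Classical.propDecidable _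
  if h : Bounded2 M then ‖h.choose‖ else 0

/-- The matrix product of two infinite matrices. -/
noncomputable def matMul (A B : I → I → ℂ) : I → I → ℂ :=
  fun i j => ∑' m : I, A i m * B m j

/-- The conjugate transpose of a matrix. -/
def conjTranspose (A : I → I → ℂ) : I → I → ℂ := fun i j => conj (A j i)

/-- A solid Banach algebra of (infinite) matrices over the index set `I`. -/
structure SolidBanachAlgebra (I : Type*) where
  carrier : Set (I → I → ℂ)
  anorm : (I → I → ℂ) → ℝ
  zero_mem : (0 : I → I → ℂ) ∈ carrier
  add_mem : ∀ A B : I → I → ℂ, A ∈ carrier → B ∈ carrier → A + B ∈ carrier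
  smul_mem : ∀ (c : ℂ) (A : I → I → ℂ), A ∈ carrier → c • A ∈ carrier
  mul_mem : ∀ A B : I → I → ℂ, A ∈ carrier → B ∈ carrier → matMul A B ∈ carrier
  anorm_nonneg : ∀ A ∈ carrier, 0 ≤ anorm A
  anorm_zero : anorm 0 = 0
  anorm_eq_zero : ∀ A ∈ carrier, anorm A = 0 → A = 0
  anorm_smul : ∀ (c : ℂ), ∀ A ∈ carrier, anorm (c • A) = ‖c‖ * anorm A
  anorm_add : ∀ A ∈ carrier, ∀ B ∈ carrier, anorm (A + B) ≤ anorm A + anorm B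
  anorm_mul : ∀ A ∈ carrier, ∀ B ∈ carrier, anorm (matMul A B) ≤ anorm A * anorm B
  complete : ∀ f : ℕ → (I → I → ℂ), (∀ n, f n ∈ carrier) →
      (∀ ε > (0 : ℝ), ∃ N : ℕ, ∀ m ≥ N, ∀ n ≥ N, anorm (f m - f n) < ε) →
      ∃ A ∈ carrier, ∀ ε > (0 : ℝ), ∃ N : ℕ, ∀ n ≥ N, anorm (f n - A) < ε
  bounded : ∀ A ∈ carrier, Bounded2 A
  solid : ∀ A ∈ carrier, ∀ B : I → I → ℂ,
      (∀ i j, ‖B i j‖ ≤ ‖A i j‖) → B ∈ carrier ∧ anorm B ≤ anorm A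

/-- A matrix algebra is involutive if it is closed under conjugate transposition and the
norm is invariant under it. -/
def SolidBanachAlgebra.Involutive (𝒜 : SolidBanachAlgebra I) : Prop :=
  ∀ A ∈ 𝒜.carrier, conjTranspose A ∈ 𝒜.carrier ∧ 𝒜.anorm (conjTranspose A) = 𝒜.anorm A

/-- Rank-four tensors `(A_{i,k,l,j})` indexed by `I₁ × I₂² × I₁`. -/
abbrev Tensor (I₁ I₂ : Type*) := I₁ → I₂ → I₂ → I₁ → ℂ

/-- The restriction `A|_{{i} × I₂² × {j}}`, an `I₂ × I₂` matrix. -/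
def res1 (A : Tensor I₁ I₂) (i j : I₁) : I₂ → I₂ → ℂ := fun k l => A i k l j

/-- The restriction `A|_{I₁ × {(k,l)} × I₁}`, an `I₁ × I₁` matrix. -/
def res2 (A : Tensor I₁ I₂) (k l : I₂) : I₁ → I₁ → ℂ := fun i j => A i k l j

/-- Membership in `Ã₁`, for a set `S` of `I₁ × I₁` matrices playing the role of `𝒜₁`:
all restrictions `A|_{{i} × I₂² × {j}}` are bounded on `ℓ²(I₂)` and the matrix of their
operator norms belongs to `S`. -/
def MemT1 (S : Set (I₁ → I₁ → ℂ)) (A : Tensor I₁ I₂) : Prop :=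
  (∀ i j : I₁, Bounded2 (res1 A i j)) ∧
    (fun i j : I₁ => (opNorm2 (res1 A i j) : ℂ)) ∈ S

/-- Membership in `Ã₂`. -/
def MemT2 (S : Set (I₂ → I₂ → ℂ)) (A : Tensor I₁ I₂) : Prop :=
  (∀ k l : I₂, Bounded2 (res2 A k l)) ∧
    (fun k l : I₂ => (opNorm2 (res2 A k l) : ℂ)) ∈ S

/-- The norm `‖A‖_{Ã₁}` (meaningful on members of `Ã₁`). -/
noncomputable def normT1 (𝒜₁ : SolidBanachAlgebra I₁) (A : Tensor I₁ I₂) : ℝ :=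
  𝒜₁.anorm (fun i j : I₁ => (opNorm2 (res1 A i j) : ℂ))

/-- The norm `‖A‖_{Ã₂}` (meaningful on members of `Ã₂`). -/
noncomputable def normT2 (𝒜₂ : SolidBanachAlgebra I₂) (A : Tensor I₁ I₂) : ℝ :=
  𝒜₂.anorm (fun k l : I₂ => (opNorm2 (res2 A k l) : ℂ))

/-- Membership in `𝒜 = Ã₁ ∩ Ã₂`. -/
def MemA (𝒜₁ : SolidBanachAlgebra I₁) (𝒜₂ : SolidBanachAlgebra I₂) (A : Tensor I₁ I₂) : Prop :=
  MemT1 𝒜₁.carrier A ∧ MemT2 𝒜₂.carrier A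

/-- The norm `‖A‖_𝒜 = max {‖A‖_{Ã₁}, ‖A‖_{Ã₂}}`. -/
noncomputable def normA (𝒜₁ : SolidBanachAlgebra I₁) (𝒜₂ : SolidBanachAlgebra I₂)
    (A : Tensor I₁ I₂) : ℝ :=
  max (normT1 𝒜₁ A) (normT2 𝒜₂ A)

/-- The matrix over `I₁ × I₂` through which a rank-four tensor acts on `ℓ²(I₁ × I₂)`:
`(Ac)_{(i,k)} = Σ_{(m,n)} A_{i,k,n,m} c_{(m,n)}`. -/
def toMatrix (A : Tensor I₁ I₂) : (I₁ × I₂) → (I₁ × I₂) → ℂ :=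
  fun p q => A p.1 p.2 q.2 q.1

/-- The rank-four tensor of matrix entries of an operator `T` on `ℓ²(I₁ × I₂)`:
its `(i,k,l,j)` entry is the `((i,k),(j,l))` matrix entry of `T`. -/
noncomputable def entryTensor (T : L2 (I₁ × I₂) →L[ℂ] L2 (I₁ × I₂)) : Tensor I₁ I₂ :=
  letI : DecidableEq (I₁ × I₂) := Classical.decEq _
  fun i k l j => (T (lp.single 2 (j, l) (1 : ℂ)) : ∀ _ : I₁ × I₂, ℂ) (i, k)

/-- A set `S` of rank-four tensors is inverse-closed if, whenever `A ∈ S` acts as a boundedly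
invertible operator on `ℓ²(I₁ × I₂)`, the rank-four tensor of matrix entries of the inverse
operator also belongs to `S`. -/
def InverseClosed (S : Set (Tensor I₁ I₂)) : Prop :=
  ∀ A ∈ S, ∀ T Tinv : L2 (I₁ × I₂) →L[ℂ] L2 (I₁ × I₂),
    Represents (toMatrix A) T →
    T.comp Tinv = ContinuousLinearMap.id ℂ (L2 (I₁ × I₂)) →
    Tinv.comp T = ContinuousLinearMap.id ℂ (L2 (I₁ × I₂)) →
    entryTensor Tinv ∈ S

/-- The doubly contracted tensor product
`(A : B)_{i,k,l,j} = Σ_{n ∈ I₂} Σ_{m ∈ I₁} A_{i,k,n,m} B_{m,n,l,j}`. -/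
noncomputable def contract (A B : Tensor I₁ I₂) : Tensor I₁ I₂ :=
  fun i k l j => ∑' n : I₂, ∑' m : I₁, A i k n m * B m n l j

/-- Absolute convergence of all series defining the doubly contracted tensor product. -/
def ContractSummable (A B : Tensor I₁ I₂) : Prop :=
  ∀ (i : I₁) (k l : I₂) (j : I₁),
    Summable (fun nm : I₂ × I₁ => ‖A i k nm.1 nm.2 * B nm.2 nm.1 l j‖)

/-- The adjoint tensor `(A*)_{i,k,l,j} = conj (A_{j,l,k,i})`. -/
def adjT (A : Tensor I₁ I₂) : Tensor I₁ I₂ := fun i k l j => conj (A j l k i)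


/-- The operator represented by a matrix is unique. -/
theorem Represents.unique {M : I → I → ℂ} {T S : L2 I →L[ℂ] L2 I}
    (hT : Represents M T) (hS : Represents M S) : T = S := by
  ext c k
  exact (hT c k).unique (hS c k)

theorem Represents.bounded2 {M : I → I → ℂ} {T : L2 I →L[ℂ] L2 I}
    (hT : Represents M T) : Bounded2 M := ⟨T, hT⟩

theorem Represents.opNorm2_eq {M : I → I → ℂ} {T : L2 I →L[ℂ] L2 I}
    (hT : Represents M T) : opNorm2 M = ‖T‖ := by
  unfold opNorm2
  rw [dif_pos hT.bounded2, hT.bounded2.choose_spec.unique hT]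

/-- The entries of a matrix are the values of its operator on the standard basis. -/
theorem Represents.apply_single [DecidableEq I] {M : I → I → ℂ} {T : L2 I →L[ℂ] L2 I}
    (hT : Represents M T) (k l : I) :
    (T (lp.single 2 l (1 : ℂ)) : ∀ _ : I, ℂ) k = M k l := by
  refine (hT (lp.single 2 l (1 : ℂ)) k).unique ?_
  convert hasSum_single (f := fun m : I =>
    M k m * (lp.single 2 l (1 : ℂ) : ∀ _ : I, ℂ) m) l ?_ using 1
  · simp
  · intro m hm
    simp [lp.single_apply, hm]

/-- The conjugate transpose of a matrix represents the Hilbert space adjoint. -/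
theorem Represents.adjoint {M : I → I → ℂ} {T : L2 I →L[ℂ] L2 I}
    (hT : Represents M T) : Represents (conjTranspose M) (ContinuousLinearMap.adjoint T) := by
  classical
  intro c k
  have h := lp.hasSum_inner (𝕜 := ℂ) (T (lp.single 2 k (1 : ℂ))) c
  rw [← ContinuousLinearMap.adjoint_inner_right, lp.inner_single_left] at h
  simpa [hT.apply_single, conjTranspose, mul_comm] using h

theorem Bounded2.conjTranspose {M : I → I → ℂ} (hM : Bounded2 M) :
    Bounded2 (conjTranspose M) :=
  hM.choose_spec.adjoint.bounded2

theorem Bounded2.opNorm2_conjTranspose {M : I → I → ℂ} (hM : Bounded2 M) :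
    opNorm2 (PaperTensor.conjTranspose M) = opNorm2 M := by
  obtain ⟨T, hT⟩ := hM
  rw [hT.opNorm2_eq, hT.adjoint.opNorm2_eq, LinearIsometryEquiv.norm_map]

theorem res1_adjT (A : Tensor I₁ I₂) (i j : I₁) :
    res1 (adjT A) i j = conjTranspose (res1 A j i) := rfl

theorem res2_adjT (A : Tensor I₁ I₂) (k l : I₂) :
    res2 (adjT A) k l = conjTranspose (res2 A l k) := rfl

/-- The matrix of operator norms of the `I₂ × I₂` restrictions of the adjoint tensor. -/
theorem opNorm2_res1_adjT {A : Tensor I₁ I₂} (hA : ∀ i j, Bounded2 (res1 A i j)) :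
    (fun i j : I₁ => (opNorm2 (res1 (adjT A) i j) : ℂ)) =
      conjTranspose (fun i j : I₁ => (opNorm2 (res1 A i j) : ℂ)) := by
  funext i j
  simp [res1_adjT, (hA j i).opNorm2_conjTranspose, conjTranspose]

/-- The matrix of operator norms of the `I₁ × I₁` restrictions of the adjoint tensor. -/
theorem opNorm2_res2_adjT {A : Tensor I₁ I₂} (hA : ∀ k l, Bounded2 (res2 A k l)) :
    (fun k l : I₂ => (opNorm2 (res2 (adjT A) k l) : ℂ)) =
      conjTranspose (fun k l : I₂ => (opNorm2 (res2 A k l) : ℂ)) := by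
  funext k l
  simp [res2_adjT, (hA l k).opNorm2_conjTranspose, conjTranspose]

/-- if `𝒜₁` and `𝒜₂` are involutive, then `𝒜` is closed under the adjoint and the
norm is invariant. -/
theorem statement7 {I₁ I₂ : Type*} [Countable I₁] [Countable I₂]
    (𝒜₁ : SolidBanachAlgebra I₁) (𝒜₂ : SolidBanachAlgebra I₂)
    (h₁ : 𝒜₁.Involutive) (h₂ : 𝒜₂.Involutive)
    (A : Tensor I₁ I₂) (hA : MemA 𝒜₁ 𝒜₂ A) :
    MemA 𝒜₁ 𝒜₂ (adjT A) ∧ normA 𝒜₁ 𝒜₂ (adjT A) = normA 𝒜₁ 𝒜₂ A := by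
  obtain ⟨⟨hb₁, hm₁⟩, hb₂, hm₂⟩ := hA
  have e₁ := opNorm2_res1_adjT hb₁
  have e₂ := opNorm2_res2_adjT hb₂
  refine ⟨⟨⟨fun i j => (hb₁ j i).conjTranspose, ?_⟩, fun k l => (hb₂ l k).conjTranspose, ?_⟩, ?_⟩
  · rw [e₁]
    exact (h₁ _ hm₁).1
  · rw [e₂]
    exact (h₂ _ hm₂).1
  · unfold normA normT1 normT2
    rw [e₁, e₂, (h₁ _ hm₁).2, (h₂ _ hm₂).2]

end PaperTensor
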